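/- Let E be a complete CAT(0) space with no bifurcating geodesics and let A be a nonempty compact subset of E. Then the set W_min = { X ∈ P^A_{b,cl,cv}(E) : min(A,X) is well-posed } is a dense G_δ-set in the metric space (P^A_{b,cl,cv}(E), h). -/

import Mathlib

open Metric Set Filter Bornology

noncomputable section

/-- A geodesic path of length `l`: a map `c : ℝ → E` that is isometric on `[0, l]`. -/
def IsGeodesicPath {E : Type*} [MetricSpace E] (c : ℝ → E) (l : ℝ) : Prop :=
  0 ≤ l ∧ ∀ s ∈ Icc (0:ℝ) l, ∀ t ∈ Icc (0:ℝ) l, dist (c s) (c t) = |s - t|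

/-- `S` is a geodesic segment joining `x` and `y`. -/
def IsGeodesicSegment {E : Type*} [MetricSpace E] (S : Set E) (x y : E) : Prop :=
  ∃ c l, IsGeodesicPath c l ∧ c 0 = x ∧ c l = y ∧ S = c '' Icc (0:ℝ) l

/-- A geodesic (line): an isometric image of `ℝ`. -/
def IsGeodesicLine {E : Type*} [MetricSpace E] (S : Set E) : Prop :=
  ∃ c : ℝ → E, Isometry c ∧ S = Set.range c

/-- `E` is a geodesic space: every two points are joined by a geodesic path. -/
def IsGeodesicSpace (E : Type*) [MetricSpace E] : Prop :=
  ∀ x y : E, ∃ S, IsGeodesicSegment S x y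

/-- `E` has the geodesic extension property: every geodesic segment is contained
in a geodesic. -/
def GeodesicExtensionProperty (E : Type*) [MetricSpace E] : Prop :=
  ∀ (S : Set E) (x y : E), IsGeodesicSegment S x y → ∃ L, IsGeodesicLine L ∧ S ⊆ L

/-- The metric of `E` is convex. -/
def HasConvexMetric (E : Type*) [MetricSpace E] : Prop :=
  ∀ (c₁ c₂ : ℝ → E) (l₁ l₂ : ℝ), IsGeodesicPath c₁ l₁ → IsGeodesicPath c₂ l₂ →
    ∀ t ∈ Icc (0:ℝ) 1,
      dist (c₁ (t * l₁)) (c₂ (t * l₂)) ≤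
        (1 - t) * dist (c₁ 0) (c₂ 0) + t * dist (c₁ l₁) (c₂ l₂)

/-- A subset `X` is (geodesically) convex: any geodesic segment joining two points
of `X` is contained in `X`. -/
def GeodesicConvex {E : Type*} [MetricSpace E] (X : Set E) : Prop :=
  ∀ x ∈ X, ∀ y ∈ X, ∀ S : Set E, IsGeodesicSegment S x y → S ⊆ X

/-- A function `f : E → ℝ` is (geodesically) convex. -/
def GeodesicConvexFun {E : Type*} [MetricSpace E] (f : E → ℝ) : Prop :=
  ∀ (c : ℝ → E) (l : ℝ), IsGeodesicPath c l → ∀ t ∈ Icc (0:ℝ) 1,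
    f (c (t * l)) ≤ (1 - t) * f (c 0) + t * f (c l)

/-- `G₁(S)`: the union of all geodesic segments with endpoints in `S`. -/
def geodSegUnion {E : Type*} [MetricSpace E] (S : Set E) : Set E :=
  {z | ∃ x ∈ S, ∃ y ∈ S, ∃ T : Set E, IsGeodesicSegment T x y ∧ z ∈ T}

/-- The iterates `G_n(S)`. -/
def geodGn {E : Type*} [MetricSpace E] (S : Set E) : ℕ → Set E
  | 0 => S
  | n + 1 => geodSegUnion (geodGn S n)

/-- The (geodesic) convex hull `co(S) = ⋃ₙ G_n(S)`. -/
def geodConvexHull {E : Type*} [MetricSpace E] (S : Set E) : Set E :=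
  ⋃ n, geodGn S n

/-- `E` is without bifurcating geodesics. -/
def NoBifurcatingGeodesics (E : Type*) [MetricSpace E] : Prop :=
  ∀ (p a b : E) (S₁ S₂ : Set E), IsGeodesicSegment S₁ p a → IsGeodesicSegment S₂ p b →
    ∀ z, z ∈ S₁ → z ∈ S₂ → z ≠ p → (z = a ∧ z = b) ∨ S₁ ⊆ S₂ ∨ S₂ ⊆ S₁

/-- `E` is reflexive: every descending sequence of nonempty, bounded, closed and convex
subsets of `E` has nonempty intersection. -/
def ReflexiveGeodesicSpace (E : Type*) [MetricSpace E] : Prop :=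
  ∀ C : ℕ → Set E, (∀ n, (C n).Nonempty) → (∀ n, IsBounded (C n)) → (∀ n, IsClosed (C n)) →
    (∀ n, GeodesicConvex (C n)) → (∀ n, C (n + 1) ⊆ C n) → (⋂ n, C n).Nonempty

/-- `Dist(x, A)`: the remotal (farthest) distance from `x` to `A`. -/
def supDist {E : Type*} [MetricSpace E] (x : E) (A : Set E) : ℝ :=
  sSup ((fun a => dist x a) '' A)

/-- `λ_{XY} = inf{ d(x,y) : x ∈ X, y ∈ Y }`. -/
def infSetDist {E : Type*} [MetricSpace E] (X Y : Set E) : ℝ :=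
  sInf (Set.image2 dist X Y)

/-- `μ_{XY} = sup{ d(x,y) : x ∈ X, y ∈ Y }`. -/
def supSetDist {E : Type*} [MetricSpace E] (X Y : Set E) : ℝ :=
  sSup (Set.image2 dist X Y)

/-- `L_{XY}(σ) = { x ∈ X : dist(x,Y) ≤ λ_{XY} + σ }`. -/
def Lset {E : Type*} [MetricSpace E] (X Y : Set E) (σ : ℝ) : Set E :=
  {x ∈ X | infDist x Y ≤ infSetDist X Y + σ}

/-- `M_{XY}(σ) = { x ∈ X : Dist(x,Y) ≥ μ_{XY} − σ }`. -/
def Mset {E : Type*} [MetricSpace E] (X Y : Set E) (σ : ℝ) : Set E :=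
  {x ∈ X | supSetDist X Y - σ ≤ supDist x Y}

/-- The minimization problem `min(X,Y)` is well-posed. -/
def MinWellPosed {E : Type*} [MetricSpace E] (X Y : Set E) : Prop :=
  ∃ x₀ ∈ X, ∃ y₀ ∈ Y, dist x₀ y₀ = infSetDist X Y ∧
    (∀ x ∈ X, ∀ y ∈ Y, dist x y = infSetDist X Y → x = x₀ ∧ y = y₀) ∧
    ∀ x : ℕ → E, ∀ y : ℕ → E, (∀ n, x n ∈ X) → (∀ n, y n ∈ Y) →
      Tendsto (fun n => dist (x n) (y n)) atTop (nhds (infSetDist X Y)) →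
      Tendsto x atTop (nhds x₀) ∧ Tendsto y atTop (nhds y₀)

/-- The maximization problem `max(X,Y)` is well-posed. -/
def MaxWellPosed {E : Type*} [MetricSpace E] (X Y : Set E) : Prop :=
  ∃ x₀ ∈ X, ∃ y₀ ∈ Y, dist x₀ y₀ = supSetDist X Y ∧
    (∀ x ∈ X, ∀ y ∈ Y, dist x y = supSetDist X Y → x = x₀ ∧ y = y₀) ∧
    ∀ x : ℕ → E, ∀ y : ℕ → E, (∀ n, x n ∈ X) → (∀ n, y n ∈ Y) →
      Tendsto (fun n => dist (x n) (y n)) atTop (nhds (supSetDist X Y)) →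
      Tendsto x atTop (nhds x₀) ∧ Tendsto y atTop (nhds y₀)

/-- The distance of the model space `M²_κ` (κ < 0): the hyperbolic distance
multiplied by `1/√(-κ)`. -/
def kdist (κ : ℝ) (a b : UpperHalfPlane) : ℝ :=
  (Real.sqrt (-κ))⁻¹ * dist a b

/-- `pb` is the comparison point in `M²_κ` (relative to the side from `xi` to `xj`,
with comparison vertices `xib`, `xjb`) of a point `p` on a geodesic segment from
`xi` to `xj`. -/
def IsComparisonPoint {E : Type*} [MetricSpace E] (κ : ℝ) (xi xj : E)
    (xib xjb : UpperHalfPlane) (p : E) (pb : UpperHalfPlane) : Prop :=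
  kdist κ xib pb = dist xi p ∧ kdist κ pb xjb = dist p xj

/-- `E` has curvature bounded below by `κ < 0`: every geodesic triangle satisfies the
reversed CAT(κ) inequality with respect to any κ-comparison triangle in `M²_κ`. -/
def CurvBoundedBelow (E : Type*) [MetricSpace E] (κ : ℝ) : Prop :=
  ∀ (x₁ x₂ x₃ : E) (S₁₂ S₂₃ S₁₃ : Set E),
    IsGeodesicSegment S₁₂ x₁ x₂ → IsGeodesicSegment S₂₃ x₂ x₃ → IsGeodesicSegment S₁₃ x₁ x₃ →
    ∀ x₁b x₂b x₃b : UpperHalfPlane,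
      kdist κ x₁b x₂b = dist x₁ x₂ → kdist κ x₂b x₃b = dist x₂ x₃ →
      kdist κ x₁b x₃b = dist x₁ x₃ →
      ∀ (p q : E) (pb qb : UpperHalfPlane),
        ((p ∈ S₁₂ ∧ IsComparisonPoint κ x₁ x₂ x₁b x₂b p pb) ∨
         (p ∈ S₂₃ ∧ IsComparisonPoint κ x₂ x₃ x₂b x₃b p pb) ∨
         (p ∈ S₁₃ ∧ IsComparisonPoint κ x₁ x₃ x₁b x₃b p pb)) →
        ((q ∈ S₁₂ ∧ IsComparisonPoint κ x₁ x₂ x₁b x₂b q qb) ∨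
         (q ∈ S₂₃ ∧ IsComparisonPoint κ x₂ x₃ x₂b x₃b q qb) ∨
         (q ∈ S₁₃ ∧ IsComparisonPoint κ x₁ x₃ x₁b x₃b q qb)) →
        kdist κ pb qb ≤ dist p q

/-- Comparison points for Euclidean (κ = 0) comparison triangles in `ℝ²`. -/
def IsComparisonPointE {E : Type*} [MetricSpace E] (xi xj : E)
    (xib xjb : EuclideanSpace ℝ (Fin 2)) (p : E) (pb : EuclideanSpace ℝ (Fin 2)) : Prop :=
  dist xib pb = dist xi p ∧ dist pb xjb = dist p xj

/-- `E` is a CAT(0) space: a geodesic space where every geodesic triangle satisfies the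
CAT(0) comparison inequality with respect to Euclidean comparison triangles. -/
def CATZero (E : Type*) [MetricSpace E] : Prop :=
  IsGeodesicSpace E ∧
  ∀ (x₁ x₂ x₃ : E) (S₁₂ S₂₃ S₁₃ : Set E),
    IsGeodesicSegment S₁₂ x₁ x₂ → IsGeodesicSegment S₂₃ x₂ x₃ → IsGeodesicSegment S₁₃ x₁ x₃ →
    ∀ x₁b x₂b x₃b : EuclideanSpace ℝ (Fin 2),
      dist x₁b x₂b = dist x₁ x₂ → dist x₂b x₃b = dist x₂ x₃ → dist x₁b x₃b = dist x₁ x₃ →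
      ∀ (p q : E) (pb qb : EuclideanSpace ℝ (Fin 2)),
        ((p ∈ S₁₂ ∧ IsComparisonPointE x₁ x₂ x₁b x₂b p pb) ∨
         (p ∈ S₂₃ ∧ IsComparisonPointE x₂ x₃ x₂b x₃b p pb) ∨
         (p ∈ S₁₃ ∧ IsComparisonPointE x₁ x₃ x₁b x₃b p pb)) →
        ((q ∈ S₁₂ ∧ IsComparisonPointE x₁ x₂ x₁b x₂b q qb) ∨
         (q ∈ S₂₃ ∧ IsComparisonPointE x₂ x₃ x₂b x₃b q qb) ∨
         (q ∈ S₁₃ ∧ IsComparisonPointE x₁ x₃ x₁b x₃b q qb)) →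
        dist p q ≤ dist pb qb

/-- The space `P_{b,cl,cv}(E)` of nonempty, bounded, closed and convex subsets of `E`. -/
def Pbclcv (E : Type*) [MetricSpace E] : Type _ :=
  {X : Set E // X.Nonempty ∧ IsBounded X ∧ IsClosed X ∧ GeodesicConvex X}

/-- `P_{b,cl,cv}(E)` carries the Pompeiu-Hausdorff distance. -/
instance Pbclcv.metricSpace (E : Type*) [MetricSpace E] : MetricSpace (Pbclcv E) where
  dist X Y := hausdorffDist X.1 Y.1
  dist_self X := hausdorffDist_self_zero
  dist_comm X Y := hausdorffDist_comm
  dist_triangle X Y Z := hausdorffDist_triangle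
    (hausdorffEdist_ne_top_of_nonempty_of_bounded X.2.1 Y.2.1 X.2.2.1 Y.2.2.1)
  eq_of_dist_eq_zero := by
    intro X Y h
    exact Subtype.ext ((X.2.2.2.1.hausdorffDist_zero_iff_eq Y.2.2.2.1
      (hausdorffEdist_ne_top_of_nonempty_of_bounded X.2.1 Y.2.1 X.2.2.1 Y.2.2.1)).mp h)

/-- `P^A_{b,cl,cv}(E)`: the closure in `(P_{b,cl,cv}(E), h)` of the family of sets at
positive distance from `A`. -/
def PAbclcv {E : Type*} [MetricSpace E] (A : Set E) : Set (Pbclcv E) :=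
  closure {X : Pbclcv E | 0 < infSetDist X.1 A}

/-- The inverse hyperbolic cosine. -/
def arcosh (x : ℝ) : ℝ := Real.log (x + Real.sqrt (x ^ 2 - 1))

/-- The function `F_κ`. -/
def Fkappa (κ d r σ : ℝ) : ℝ :=
  2 / Real.sqrt (-κ) *
    arcosh (Real.cosh (Real.sqrt (-κ) * (r - d + σ)) ^ 2 -
      Real.sinh (Real.sqrt (-κ) * (r - d + σ)) / Real.sinh (Real.sqrt (-κ) * d) *
        (Real.cosh (Real.sqrt (-κ) * r) -
          Real.cosh (Real.sqrt (-κ) * d) * Real.cosh (Real.sqrt (-κ) * (r - d + σ))))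

/-- The petal `P_{α,δ}(x₀, f)`. -/
def petal {E : Type*} [MetricSpace E] (f : E → ℝ) (α δ : ℝ) (x₀ : E) : Set E :=
  {x | f x ≤ f x₀ - α * dist x x₀ + δ}

/-- `L_{A,f}(σ)`. -/
def LsetFun {E : Type*} [MetricSpace E] (A : Set E) (f : E → ℝ) (σ : ℝ) : Set E :=
  {x | f x ≤ sInf (f '' A) + σ ∧ infDist x A ≤ σ}

/-- The problem `min(A,f)` is well-posed in the sense of Revalski. -/
def RevalskiWellPosed {E : Type*} [MetricSpace E] (A : Set E) (f : E → ℝ) : Prop :=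
  sInf ((fun σ => diam (LsetFun A f σ)) '' Ioi 0) = 0

/-- The nearest point problem `min(X,y)` is well-posed. -/
def PointMinWellPosed {E : Type*} [MetricSpace E] (X : Set E) (y : E) : Prop :=
  ∃ x₀ ∈ X, dist x₀ y = infDist y X ∧ (∀ x ∈ X, dist x y = infDist y X → x = x₀) ∧
    ∀ x : ℕ → E, (∀ n, x n ∈ X) →
      Tendsto (fun n => dist (x n) y) atTop (nhds (infDist y X)) →
      Tendsto x atTop (nhds x₀)

end

section GeodesicPaths

variable {E : Type*} [MetricSpace E]

theorem mul_mem_Icc_of_mem_unitInterval {l t : ℝ} (hl : 0 ≤ l) (ht : t ∈ Icc (0:ℝ) 1) :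
    t * l ∈ Icc (0:ℝ) l :=
  ⟨mul_nonneg ht.1 hl, mul_le_of_le_one_left hl ht.2⟩

theorem IsGeodesicPath.dist_eq {c : ℝ → E} {l : ℝ} (hc : IsGeodesicPath c l) :
    dist (c 0) (c l) = l := by
  rw [hc.2 0 ⟨le_rfl, hc.1⟩ l ⟨hc.1, le_rfl⟩, zero_sub, abs_neg, abs_of_nonneg hc.1]

theorem IsGeodesicPath.dist_left {c : ℝ → E} {l t : ℝ} (hc : IsGeodesicPath c l)
    (ht : t ∈ Icc (0:ℝ) 1) : dist (c 0) (c (t * l)) = t * l := by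
  have h := mul_mem_Icc_of_mem_unitInterval hc.1 ht
  rw [hc.2 0 ⟨le_rfl, hc.1⟩ _ h, zero_sub, abs_neg, abs_of_nonneg h.1]

theorem IsGeodesicPath.dist_right {c : ℝ → E} {l t : ℝ} (hc : IsGeodesicPath c l)
    (ht : t ∈ Icc (0:ℝ) 1) : dist (c (t * l)) (c l) = (1 - t) * l := by
  have h := mul_mem_Icc_of_mem_unitInterval hc.1 ht
  rw [hc.2 _ h l ⟨hc.1, le_rfl⟩, abs_sub_comm, abs_of_nonneg (sub_nonneg.2 h.2)]
  ring

theorem IsGeodesicPath.segment {c : ℝ → E} {l : ℝ} (hc : IsGeodesicPath c l) :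
    IsGeodesicSegment (c '' Icc 0 l) (c 0) (c l) :=
  ⟨c, l, hc, rfl, rfl, rfl⟩

theorem IsGeodesicPath.reverse {c : ℝ → E} {l : ℝ} (hc : IsGeodesicPath c l) :
    IsGeodesicPath (fun s => c (l - s)) l := by
  refine ⟨hc.1, fun s hs t ht => ?_⟩
  rw [hc.2 _ ⟨by linarith [hs.2], by linarith [hs.1]⟩ _ ⟨by linarith [ht.2], by linarith [ht.1]⟩,
    abs_sub_comm]
  congr 1
  ring

theorem isGeodesicPath_const (x : E) : IsGeodesicPath (fun _ => x) 0 := by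
  refine ⟨le_rfl, fun s hs t ht => ?_⟩
  rw [le_antisymm hs.2 hs.1, le_antisymm ht.2 ht.1]
  simp

theorem IsGeodesicSpace.exists_path (h : IsGeodesicSpace E) (x y : E) :
    ∃ c : ℝ → E, IsGeodesicPath c (dist x y) ∧ c 0 = x ∧ c (dist x y) = y := by
  obtain ⟨S, c, l, hc, rfl, rfl, -⟩ := h x y
  rw [hc.dist_eq]
  exact ⟨c, hc, rfl, rfl⟩

/-- Two geodesics can be concatenated when the triangle inequality is an equality. -/
theorem IsGeodesicSpace.exists_segment_through (h : IsGeodesicSpace E) {x y z : E}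
    (hxyz : dist x y + dist y z = dist x z) : ∃ S, IsGeodesicSegment S x z ∧ y ∈ S := by
  obtain ⟨c, hc, hc0, hc1⟩ := h.exists_path x y
  obtain ⟨c', hc', hc0', hc1'⟩ := h.exists_path y z
  set p := dist x y
  set q := dist y z
  let f : ℝ → E := fun s => if s ≤ p then c s else c' (s - p)
  have hf0 : f 0 = x := by simp [f, hc.1, hc0]
  have hfp : f p = y := by simp [f, hc1]
  have hf1 : f (p + q) = z := by
    rcases hc'.1.eq_or_lt with hq | hq
    · simp only [f, ← hq, add_zero, le_refl, if_true]
      rw [hc1, ← hc0', ← hc1', ← hq]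
    · simp [f, not_le.2 hq, hc1']
  have hle : ∀ s ∈ Icc (0:ℝ) (p + q), ∀ t ∈ Icc (0:ℝ) (p + q), s ≤ t →
      dist (f s) (f t) ≤ t - s := by
    intro s hs t ht hst
    by_cases htp : t ≤ p
    · simp only [f, htp, hst.trans htp, if_true]
      rw [hc.2 s ⟨hs.1, hst.trans htp⟩ t ⟨ht.1, htp⟩, abs_sub_comm, abs_of_nonneg (by linarith)]
    · have htp' := not_le.1 htp
      have htq : t - p ∈ Icc (0:ℝ) q := ⟨by linarith, by linarith [ht.2]⟩
      by_cases hsp : s ≤ p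
      · simp only [f, htp, hsp, if_true, if_false]
        have h1 := hc.2 s ⟨hs.1, hsp⟩ p ⟨hc.1, le_rfl⟩
        have h2 := hc'.2 0 ⟨le_rfl, hc'.1⟩ _ htq
        rw [abs_sub_comm, abs_of_nonneg (by linarith)] at h1
        rw [abs_sub_comm, abs_of_nonneg (by linarith), hc0', ← hc1] at h2
        linarith [dist_triangle (c s) (c p) (c' (t - p))]
      · simp only [f, htp, hsp, if_false]
        rw [hc'.2 _ ⟨by linarith, by linarith [hs.2]⟩ _ htq, abs_sub_comm,
          abs_of_nonneg (by linarith)]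
        linarith
  have heq : ∀ s ∈ Icc (0:ℝ) (p + q), ∀ t ∈ Icc (0:ℝ) (p + q), s ≤ t →
      dist (f s) (f t) = t - s := by
    intro s hs t ht hst
    have h0 : (0:ℝ) ∈ Icc (0:ℝ) (p + q) := ⟨le_rfl, hs.1.trans hs.2⟩
    have h1 : p + q ∈ Icc (0:ℝ) (p + q) := ⟨hs.1.trans hs.2, le_rfl⟩
    have e1 := hle 0 h0 s hs hs.1
    have e2 := hle s hs t ht hst
    have e3 := hle t ht _ h1 ht.2
    have e4 := dist_triangle4 (f 0) (f s) (f t) (f (p + q))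
    rw [hf0, hf1, ← hxyz] at e4
    rw [hf0] at e1
    rw [hf1] at e3
    linarith
  refine ⟨f '' Icc 0 (p + q), ⟨f, p + q, ⟨add_nonneg hc.1 hc'.1, fun s hs t ht => ?_⟩,
    hf0, hf1, rfl⟩, p, ⟨hc.1, le_add_of_nonneg_right hc'.1⟩, hfp⟩
  rcases le_total s t with hst | hst
  · rw [heq s hs t ht hst, abs_sub_comm, abs_of_nonneg (sub_nonneg.2 hst)]
  · rw [dist_comm, heq t ht s hs hst, abs_of_nonneg (sub_nonneg.2 hst)]

theorem IsGeodesicSegment.eq_of_subset {S T : Set E} {x y z : E} (hS : IsGeodesicSegment S x y)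
    (hT : IsGeodesicSegment T x z) (hST : S ⊆ T) (h : dist x y = dist x z) : y = z := by
  obtain ⟨c, l, hc, rfl, rfl, rfl⟩ := hS
  obtain ⟨c', l', hc', h0, rfl, rfl⟩ := hT
  obtain ⟨s, hs, hsy⟩ := hST ⟨l, ⟨hc.1, le_rfl⟩, rfl⟩
  rw [← h0, hc'.dist_eq, ← hsy, hc'.2 0 ⟨le_rfl, hc'.1⟩ s hs, zero_sub, abs_neg,
    abs_of_nonneg hs.1] at h
  rw [← hsy, h]

/-- Without bifurcation, a nontrivial geodesic from `x` to `y` has at most one extension of a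
given length. -/
theorem NoBifurcatingGeodesics.eq_of_dist_eq (hbif : NoBifurcatingGeodesics E)
    (hg : IsGeodesicSpace E) {x y a b : E} (hxy : y ≠ x)
    (ha : dist x y + dist y a = dist x a) (hb : dist x y + dist y b = dist x b)
    (hab : dist x a = dist x b) : a = b := by
  obtain ⟨S, hS, hyS⟩ := hg.exists_segment_through ha
  obtain ⟨T, hT, hyT⟩ := hg.exists_segment_through hb
  rcases hbif x a b S T hS hT y hyS hyT hxy with ⟨h1, h2⟩ | h | h
  · exact h1.symm.trans h2
  · exact hS.eq_of_subset hT h hab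
  · exact (hT.eq_of_subset hS h hab.symm).symm

end GeodesicPaths

section Comparison

variable {E : Type*} [MetricSpace E]

theorem exists_comparison_triangle (x y z : E) :
    ∃ x' y' z' : EuclideanSpace ℝ (Fin 2),
      dist x' y' = dist x y ∧ dist y' z' = dist y z ∧ dist x' z' = dist x z := by
  have h1 := dist_triangle x y z
  have h2 := dist_triangle_left y z x
  have h3 := dist_triangle_right x y z
  have ha : 0 ≤ dist x y := dist_nonneg
  have hb : 0 ≤ dist x z := dist_nonneg
  have hc : 0 ≤ dist y z := dist_nonneg
  generalize dist x y = a at *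
  generalize dist x z = b at *
  generalize dist y z = c at *
  obtain ⟨u, hu, hub⟩ : ∃ u : ℝ, 2 * a * u = a ^ 2 + b ^ 2 - c ^ 2 ∧ u ^ 2 ≤ b ^ 2 := by
    rcases ha.eq_or_lt with rfl | ha
    · have : b = c := by linarith
      exact ⟨0, by simp [this], by simpa using sq_nonneg b⟩
    · refine ⟨(a ^ 2 + b ^ 2 - c ^ 2) / (2 * a), by field_simp, ?_⟩
      rw [sq_le_sq, abs_of_nonneg hb, abs_le, le_div_iff₀ (by positivity),
        div_le_iff₀ (by positivity)]
      constructor <;> nlinarith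
  have hv : Real.sqrt (b ^ 2 - u ^ 2) ^ 2 = b ^ 2 - u ^ 2 := Real.sq_sqrt (by linarith)
  refine ⟨!₂[0, 0], !₂[a, 0], !₂[u, Real.sqrt (b ^ 2 - u ^ 2)], ?_, ?_, ?_⟩ <;>
    refine (sq_eq_sq₀ dist_nonneg (by assumption)).1 ?_ <;>
    simp [EuclideanSpace.dist_sq_eq, Fin.sum_univ_two, Real.dist_eq, sq_abs] <;> nlinarith

theorem isComparisonPointE_lineMap {c : ℝ → E} {l t : ℝ} (hc : IsGeodesicPath c l)
    (ht : t ∈ Icc (0:ℝ) 1) {x' y' : EuclideanSpace ℝ (Fin 2)}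
    (h : dist x' y' = dist (c 0) (c l)) :
    IsComparisonPointE (c 0) (c l) x' y' (c (t * l)) (AffineMap.lineMap x' y' t) := by
  rw [hc.dist_eq] at h
  refine ⟨?_, ?_⟩
  · rw [dist_left_lineMap, h, hc.dist_left ht, Real.norm_eq_abs, abs_of_nonneg ht.1]
  · rw [dist_lineMap_right, h, hc.dist_right ht, Real.norm_eq_abs,
      abs_of_nonneg (sub_nonneg.2 ht.2)]

theorem CATZero.dist_le_of_common_start (hcat : CATZero E) {c₁ c₂ : ℝ → E} {l₁ l₂ t : ℝ}
    (h₁ : IsGeodesicPath c₁ l₁) (h₂ : IsGeodesicPath c₂ l₂) (h0 : c₁ 0 = c₂ 0)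
    (ht : t ∈ Icc (0:ℝ) 1) :
    dist (c₁ (t * l₁)) (c₂ (t * l₂)) ≤ t * dist (c₁ l₁) (c₂ l₂) := by
  obtain ⟨x', y', z', hxy, hyz, hxz⟩ := exists_comparison_triangle (c₁ 0) (c₁ l₁) (c₂ l₂)
  obtain ⟨S, hS⟩ := hcat.1 (c₁ l₁) (c₂ l₂)
  have hseg : IsGeodesicSegment (c₂ '' Icc 0 l₂) (c₁ 0) (c₂ l₂) := h0 ▸ h₂.segment
  have key := hcat.2 _ _ _ _ _ _ h₁.segment hS hseg x' y' z' hxy hyz hxz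
    (c₁ (t * l₁)) (c₂ (t * l₂)) (AffineMap.lineMap x' y' t) (AffineMap.lineMap x' z' t)
    (Or.inl ⟨mem_image_of_mem _ (mul_mem_Icc_of_mem_unitInterval h₁.1 ht),
      isComparisonPointE_lineMap h₁ ht hxy⟩)
    (Or.inr (Or.inr ⟨mem_image_of_mem _ (mul_mem_Icc_of_mem_unitInterval h₂.1 ht),
      h0 ▸ isComparisonPointE_lineMap h₂ ht (h0 ▸ hxz)⟩))
  refine key.trans_eq ?_
  rw [← hyz, dist_eq_norm, dist_eq_norm, AffineMap.lineMap_apply_module,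
    AffineMap.lineMap_apply_module, add_sub_add_left_eq_sub, ← smul_sub, norm_smul,
    Real.norm_eq_abs, abs_of_nonneg ht.1]

theorem CATZero.hasConvexMetric (hcat : CATZero E) : HasConvexMetric E := by
  intro c₁ c₂ l₁ l₂ h₁ h₂ t ht
  obtain ⟨c, hc, hc0, hc1⟩ := hcat.1.exists_path (c₁ 0) (c₂ l₂)
  set l := dist (c₁ 0) (c₂ l₂)
  have e1 := hcat.dist_le_of_common_start h₁ hc hc0.symm ht
  have e2 := hcat.dist_le_of_common_start hc.reverse h₂.reverse (t := 1 - t)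
    (by simp [hc1]) ⟨by linarith [ht.2], by linarith [ht.1]⟩
  have r1 : l - (1 - t) * l = t * l := by ring
  have r2 : l₂ - (1 - t) * l₂ = t * l₂ := by ring
  simp only [r1, r2, sub_self, hc0] at e2
  rw [hc1] at e1
  linarith [dist_triangle (c₁ (t * l₁)) (c (t * l)) (c₂ (t * l₂))]

/-- The Bruhat–Tits inequality. -/
theorem CATZero.dist_sq_midpoint_le (hcat : CATZero E) {c : ℝ → E} {l : ℝ}
    (hc : IsGeodesicPath c l) (p : E) :
    4 * dist p (c (1 / 2 * l)) ^ 2 ≤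
      2 * dist p (c 0) ^ 2 + 2 * dist p (c l) ^ 2 - dist (c 0) (c l) ^ 2 := by
  obtain ⟨x', y', z', hxy, hyz, hxz⟩ := exists_comparison_triangle (c 0) (c l) p
  obtain ⟨S, hS⟩ := hcat.1 (c l) p
  obtain ⟨T, hT⟩ := hcat.1 (c 0) p
  have hpT : p ∈ T := by
    obtain ⟨c', l', hc', -, rfl, rfl⟩ := hT
    exact ⟨l', ⟨hc'.1, le_rfl⟩, rfl⟩
  have ht : (1 / 2 : ℝ) ∈ Icc (0:ℝ) 1 := by norm_num
  have key := hcat.2 _ _ _ _ _ _ hc.segment hS hT x' y' z' hxy hyz hxz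
    (c (1 / 2 * l)) p (AffineMap.lineMap x' y' (1 / 2 : ℝ)) z'
    (Or.inl ⟨mem_image_of_mem _ (mul_mem_Icc_of_mem_unitInterval hc.1 ht),
      isComparisonPointE_lineMap hc ht hxy⟩)
    (Or.inr (Or.inr ⟨hpT, hxz, by simp⟩))
  have par := parallelogram_law_with_norm ℝ (x' - z') (y' - z')
  rw [sub_sub_sub_cancel_right] at par
  have hm : 2 * dist (AffineMap.lineMap x' y' (1 / 2 : ℝ)) z' = ‖x' - z' + (y' - z')‖ := by
    have h2 : x' - z' + (y' - z') = (2 : ℝ) • (AffineMap.lineMap x' y' (1 / 2 : ℝ) - z') := by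
      rw [AffineMap.lineMap_apply_module]
      module
    rw [h2, norm_smul, dist_eq_norm, Real.norm_ofNat]
  rw [← hm, ← dist_eq_norm, ← dist_eq_norm, ← dist_eq_norm, hxy, hyz, hxz] at par
  rw [dist_comm p, dist_comm p, dist_comm p]
  have := mul_self_le_mul_self dist_nonneg key
  nlinarith

end Comparison

section ConvexFunctions

variable {E : Type*} [MetricSpace E]

theorem HasConvexMetric.geodesicConvexFun_dist (h : HasConvexMetric E) (p : E) :
    GeodesicConvexFun fun x => dist x p := by
  intro c l hc t ht
  exact h c (fun _ => p) l 0 hc (isGeodesicPath_const p) t ht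

theorem HasConvexMetric.geodesicConvexFun_infDist (h : HasConvexMetric E)
    (hg : IsGeodesicSpace E) {X : Set E} (hX : X.Nonempty) (hXc : GeodesicConvex X) :
    GeodesicConvexFun fun x => infDist x X := by
  intro c l hc t ht
  refine le_of_forall_pos_le_add fun ε hε => ?_
  obtain ⟨x, hx, hx'⟩ := (infDist_lt_iff hX).1 (lt_add_of_pos_right (infDist (c 0) X) hε)
  obtain ⟨y, hy, hy'⟩ := (infDist_lt_iff hX).1 (lt_add_of_pos_right (infDist (c l) X) hε)
  obtain ⟨c', hc', rfl, hc1'⟩ := hg.exists_path x y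
  have hmem : c' (t * dist (c' 0) y) ∈ X :=
    hXc _ hx _ hy _ ⟨c', _, hc', rfl, hc1', rfl⟩
      (mem_image_of_mem _ (mul_mem_Icc_of_mem_unitInterval hc'.1 ht))
  have e := h c c' l _ hc hc' t ht
  rw [hc1'] at e
  have := infDist_le_dist_of_mem (x := c (t * l)) hmem
  nlinarith [ht.1, ht.2]

theorem GeodesicConvexFun.geodesicConvex_sublevel {f : E → ℝ} (hf : GeodesicConvexFun f) (r : ℝ) :
    GeodesicConvex {x | f x ≤ r} := by
  rintro x hx y hy S ⟨c, l, hc, rfl, rfl, rfl⟩ _ ⟨s, hs, rfl⟩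
  simp only [mem_ofPred_eq] at hx hy ⊢
  rcases hc.1.eq_or_lt with rfl | hl
  · rwa [le_antisymm hs.2 hs.1]
  · have ht : s / l ∈ Icc (0:ℝ) 1 := ⟨div_nonneg hs.1 hl.le, (div_le_one hl).2 hs.2⟩
    have := hf c l hc _ ht
    rw [div_mul_cancel₀ _ hl.ne'] at this
    nlinarith [ht.1, ht.2]

theorem GeodesicConvexFun.add_const_mul {f g : E → ℝ} (hf : GeodesicConvexFun f)
    (hg : GeodesicConvexFun g) {α : ℝ} (hα : 0 ≤ α) :
    GeodesicConvexFun fun x => f x + α * g x := by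
  intro c l hc t ht
  have h1 := hf c l hc t ht
  have h2 := mul_le_mul_of_nonneg_left (hg c l hc t ht) hα
  linarith

end ConvexFunctions

section Projection

variable {E : Type*} [MetricSpace E] [CompleteSpace E]

theorem CATZero.exists_dist_eq_infDist (hcat : CATZero E) {X : Set E} (hX : X.Nonempty)
    (hXcl : IsClosed X) (hXc : GeodesicConvex X) (p : E) : ∃ x ∈ X, dist p x = infDist p X := by
  set D := infDist p X
  have hD : 0 ≤ D := infDist_nonneg
  choose x hxX hxd using fun n : ℕ =>
    (infDist_lt_iff hX).1 (lt_add_of_pos_right D (Nat.one_div_pos_of_nat (n := n) (α := ℝ)))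
  have hlim : Tendsto (fun n : ℕ => D + 1 / ((n : ℝ) + 1)) atTop (nhds D) := by
    simpa using tendsto_one_div_add_atTop_nhds_zero_nat.const_add D
  have hcau : CauchySeq x := by
    refine cauchySeq_of_le_tendsto_0
      (fun N : ℕ => Real.sqrt (4 * (D + 1 / ((N : ℝ) + 1)) ^ 2 - 4 * D ^ 2)) ?_ ?_
    · intro n m N hn hm
      refine Real.le_sqrt_of_sq_le ?_
      have hbd : ∀ k : ℕ, N ≤ k → dist p (x k) ^ 2 ≤ (D + 1 / ((N : ℝ) + 1)) ^ 2 := fun k hk =>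
        pow_le_pow_left₀ dist_nonneg
          ((hxd k).le.trans (add_le_add_right (Nat.one_div_le_one_div hk) D)) 2
      obtain ⟨c, hc, hc0, hc1⟩ := hcat.1.exists_path (x n) (x m)
      have hmem := hXc _ (hxX n) _ (hxX m) _
        ⟨c, _, hc, hc0, hc1, rfl⟩ (mem_image_of_mem c
        (mul_mem_Icc_of_mem_unitInterval hc.1 (t := 1 / 2) (by norm_num)))
      have hcn := hcat.dist_sq_midpoint_le hc p
      rw [hc0, hc1] at hcn
      have := pow_le_pow_left₀ hD (infDist_le_dist_of_mem (x := p) hmem) 2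
      linarith [hbd n hn, hbd m hm]
    · have := (((hlim.pow 2).const_mul 4).sub_const (4 * D ^ 2)).sqrt
      simpa using this
  obtain ⟨y, hy⟩ := cauchySeq_tendsto_of_complete hcau
  have hyX : y ∈ X := hXcl.mem_of_tendsto hy (Eventually.of_forall hxX)
  exact ⟨y, hyX, le_antisymm (le_of_tendsto_of_tendsto' (tendsto_const_nhds.dist hy) hlim
    fun n => (hxd n).le) (infDist_le_dist_of_mem hyX)⟩

end Projection

section InfSetDist

variable {E : Type*} [MetricSpace E]

theorem infSetDist_comm (X Y : Set E) : infSetDist X Y = infSetDist Y X := by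
  unfold infSetDist
  rw [image2_swap]
  simp only [dist_comm]

theorem bddBelow_image2_dist (X Y : Set E) : BddBelow (image2 dist X Y) :=
  ⟨0, by rintro _ ⟨x, -, y, -, rfl⟩; exact dist_nonneg⟩

theorem infSetDist_le_dist {X Y : Set E} {x y : E} (hx : x ∈ X) (hy : y ∈ Y) :
    infSetDist X Y ≤ dist x y :=
  csInf_le (bddBelow_image2_dist X Y) ⟨x, hx, y, hy, rfl⟩

theorem le_infSetDist {X Y : Set E} (hX : X.Nonempty) (hY : Y.Nonempty) {r : ℝ}
    (h : ∀ x ∈ X, ∀ y ∈ Y, r ≤ dist x y) : r ≤ infSetDist X Y :=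
  le_csInf (hX.image2 hY) (by rintro _ ⟨x, hx, y, hy, rfl⟩; exact h x hx y hy)

theorem exists_dist_lt_of_infSetDist_lt {X Y : Set E} (hX : X.Nonempty) (hY : Y.Nonempty) {r : ℝ}
    (h : infSetDist X Y < r) : ∃ x ∈ X, ∃ y ∈ Y, dist x y < r := by
  obtain ⟨_, ⟨x, hx, y, hy, rfl⟩, h⟩ := exists_lt_of_csInf_lt (hX.image2 hY) h
  exact ⟨x, hx, y, hy, h⟩

theorem infSetDist_le_infDist {X Y : Set E} (hY : Y.Nonempty) {x : E} (hx : x ∈ X) :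
    infSetDist X Y ≤ infDist x Y :=
  (le_infDist hY).2 fun _ hy => infSetDist_le_dist hx hy

end InfSetDist

section WellPosed

variable {E : Type*} [MetricSpace E]

/-- Near-optimal pairs for `min(A, X)` lie within distance less than `r` of each other. -/
def MinGapLT (A X : Set E) (r : ℝ) : Prop :=
  ∃ r' < r, ∃ σ > 0, ∀ a ∈ A, ∀ x ∈ X, ∀ b ∈ A, ∀ y ∈ X,
    dist a x ≤ infSetDist A X + σ → dist b y ≤ infSetDist A X + σ → dist a b + dist x y ≤ r'

theorem isOpen_minGapLT {A : Set E} (hA : A.Nonempty) (r : ℝ) :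
    IsOpen {X : Pbclcv E | MinGapLT A X.1 r} := by
  rw [Metric.isOpen_iff]
  rintro X ⟨r', hr', σ, hσ, h⟩
  set δ := min (σ / 4) ((r - r') / 4)
  have hδ : 0 < δ := lt_min (by linarith) (by linarith)
  have hδσ : δ ≤ σ / 4 := min_le_left _ _
  have hδr : δ ≤ (r - r') / 4 := min_le_right _ _
  refine ⟨δ, hδ, fun Y hY => ?_⟩
  have hd : hausdorffDist Y.1 X.1 < δ := hY
  have hfin := hausdorffEDist_ne_top_of_nonempty_of_bounded Y.2.1 X.2.1 Y.2.2.1 X.2.2.1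
  have hYX : infSetDist A Y.1 ≤ infSetDist A X.1 + δ := by
    rw [← sub_le_iff_le_add]
    refine le_infSetDist hA X.2.1 fun a ha x hx => ?_
    obtain ⟨y, hy, hxy⟩ := exists_dist_lt_of_hausdorffDist_lt' hx hd hfin
    linarith [infSetDist_le_dist ha hy, dist_triangle_right a y x, dist_comm x y]
  refine ⟨r' + 2 * δ, by linarith, σ / 2, by linarith, fun a ha x hx b hb y hy hax hby => ?_⟩
  obtain ⟨x', hx', hxx⟩ := exists_dist_lt_of_hausdorffDist_lt hx hd hfin
  obtain ⟨y', hy', hyy⟩ := exists_dist_lt_of_hausdorffDist_lt hy hd hfin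
  have := h a ha x' hx' b hb y' hy' (by linarith [dist_triangle a x x'])
    (by linarith [dist_triangle b y y'])
  linarith [dist_triangle4_right x y x' y']

theorem MinWellPosed.minGapLT {A X : Set E} (h : MinWellPosed A X) {r : ℝ} (hr : 0 < r) :
    MinGapLT A X r := by
  obtain ⟨a₀, -, x₀, -, -, -, hseq⟩ := h
  by_contra hcon
  simp only [MinGapLT] at hcon
  push Not at hcon
  choose a ha x hx b hb y hy hax hby hgap using fun n : ℕ =>
    hcon (r / 2) (half_lt_self hr) (1 / ((n : ℝ) + 1)) Nat.one_div_pos_of_nat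
  have hlim : Tendsto (fun n : ℕ => infSetDist A X + 1 / ((n : ℝ) + 1)) atTop
      (nhds (infSetDist A X)) := by
    simpa using tendsto_one_div_add_atTop_nhds_zero_nat.const_add (infSetDist A X)
  obtain ⟨h1, h2⟩ := hseq a x ha hx (tendsto_of_tendsto_of_tendsto_of_le_of_le tendsto_const_nhds
    hlim (fun n => infSetDist_le_dist (ha n) (hx n)) hax)
  obtain ⟨h3, h4⟩ := hseq b y hb hy (tendsto_of_tendsto_of_tendsto_of_le_of_le tendsto_const_nhds
    hlim (fun n => infSetDist_le_dist (hb n) (hy n)) hby)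
  have := ge_of_tendsto' ((h1.dist h3).add (h2.dist h4)) fun n => (hgap n).le
  simp only [dist_self, add_zero] at this
  linarith

theorem minWellPosed_of_forall_minGapLT [CompleteSpace E] {A X : Set E} (hA : A.Nonempty)
    (hX : X.Nonempty) (hAcl : IsClosed A) (hXcl : IsClosed X) (h : ∀ r > 0, MinGapLT A X r) :
    MinWellPosed A X := by
  set m := infSetDist A X with hm
  have hlim : Tendsto (fun n : ℕ => m + 1 / ((n : ℝ) + 1)) atTop (nhds m) := by
    simpa using tendsto_one_div_add_atTop_nhds_zero_nat.const_add m
  choose a ha x hx hax using fun n : ℕ => exists_dist_lt_of_infSetDist_lt hA hX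
    (lt_add_of_pos_right m (Nat.one_div_pos_of_nat (n := n) (α := ℝ)))
  have htend : Tendsto (fun n => dist (a n) (x n)) atTop (nhds m) :=
    tendsto_of_tendsto_of_tendsto_of_le_of_le tendsto_const_nhds
      hlim (fun n => infSetDist_le_dist (ha n) (hx n)) fun n => (hax n).le
  have hcau : CauchySeq fun n => (a n, x n) := by
    rw [Metric.cauchySeq_iff]
    intro r hr
    obtain ⟨r', hr', σ, hσ, hgap⟩ := h r hr
    obtain ⟨N, hN⟩ := eventually_atTop.1 (htend.eventually_le_const (lt_add_of_pos_right m hσ))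
    refine ⟨N, fun i hi j hj => ?_⟩
    have := hgap _ (ha i) _ (hx i) _ (ha j) _ (hx j) (hN i hi) (hN j hj)
    rw [Prod.dist_eq, max_lt_iff]
    constructor <;> linarith [dist_nonneg (x := a i) (y := a j), dist_nonneg (x := x i) (y := x j)]
  obtain ⟨⟨a₀, x₀⟩, hlim₀⟩ := cauchySeq_tendsto_of_complete hcau
  have ha₀ := hlim₀.fst_nhds
  have hx₀ := hlim₀.snd_nhds
  simp only at ha₀ hx₀
  have ha₀A : a₀ ∈ A := hAcl.mem_of_tendsto ha₀ (Eventually.of_forall ha)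
  have hx₀X : x₀ ∈ X := hXcl.mem_of_tendsto hx₀ (Eventually.of_forall hx)
  have hd₀ : dist a₀ x₀ = m := tendsto_nhds_unique (ha₀.dist hx₀) htend
  have hseq : ∀ b y : ℕ → E, (∀ n, b n ∈ A) → (∀ n, y n ∈ X) →
      Tendsto (fun n => dist (b n) (y n)) atTop (nhds m) →
      Tendsto b atTop (nhds a₀) ∧ Tendsto y atTop (nhds x₀) := by
    intro b y hb hy hby
    have key : ∀ r > 0, ∀ᶠ n in atTop, dist (b n) a₀ + dist (y n) x₀ < r := by
      intro r hr
      obtain ⟨r', hr', σ, hσ, hgap⟩ := h r hr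
      filter_upwards [hby.eventually_le_const (lt_add_of_pos_right m hσ)] with n hn
      exact (hgap _ (hb n) _ (hy n) _ ha₀A _ hx₀X hn (by linarith)).trans_lt hr'
    constructor <;> refine Metric.tendsto_nhds.2 fun r hr => (key r hr).mono fun n hn => ?_
    · linarith [dist_nonneg (x := y n) (y := x₀)]
    · linarith [dist_nonneg (x := b n) (y := a₀)]
  refine ⟨a₀, ha₀A, x₀, hx₀X, hd₀, fun b hb y hy hby => ?_, hseq⟩
  obtain ⟨h1, h2⟩ := hseq (fun _ => b) (fun _ => y) (fun _ => hb) (fun _ => hy)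
    (by simp only [hby]; exact tendsto_const_nhds)
  exact ⟨tendsto_nhds_unique tendsto_const_nhds h1, tendsto_nhds_unique tendsto_const_nhds h2⟩

theorem isGδ_minWellPosed [CompleteSpace E] {A : Set E} (hA : A.Nonempty) (hAcl : IsClosed A) :
    IsGδ {X : Pbclcv E | MinWellPosed A X.1} := by
  have : {X : Pbclcv E | MinWellPosed A X.1} =
      ⋂ n : ℕ, {X : Pbclcv E | MinGapLT A X.1 (1 / ((n : ℝ) + 1))} := by
    ext X
    simp only [mem_ofPred_eq, mem_iInter]
    refine ⟨fun h n => h.minGapLT Nat.one_div_pos_of_nat, fun h =>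
      minWellPosed_of_forall_minGapLT hA X.2.1 hAcl X.2.2.2.1 fun r hr => ?_⟩
    obtain ⟨n, hn⟩ := exists_nat_one_div_lt hr
    obtain ⟨r', hr', h'⟩ := h n
    exact ⟨r', hr'.trans hn, h'⟩
  rw [this]
  exact IsGδ.iInter_of_isOpen fun n => isOpen_minGapLT hA _

end WellPosed

section Density

variable {E : Type*} [MetricSpace E]

/-- The set `{z | dist(z, X) + α d(z, y) ≤ ε}`, the tip of which is `y` when `dist(y, X) = ε`. -/
def drop (X : Set E) (y : E) (α ε : ℝ) : Set E :=
  {z | infDist z X + α * dist z y ≤ ε}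

theorem isClosed_drop (X : Set E) (y : E) (α ε : ℝ) : IsClosed (drop X y α ε) :=
  isClosed_le ((continuous_infDist_pt X).add
    (continuous_const.mul (continuous_id.dist continuous_const))) continuous_const

theorem isBounded_drop (X : Set E) (y : E) {α : ℝ} (hα : 0 < α) (ε : ℝ) :
    IsBounded (drop X y α ε) := by
  refine isBounded_closedBall.subset (t := closedBall y (ε / α)) fun z hz => ?_
  rw [mem_closedBall, le_div_iff₀' hα]
  have : infDist z X + α * dist z y ≤ ε := hz
  linarith [infDist_nonneg (x := z) (s := X)]

theorem CATZero.geodesicConvex_drop (hcat : CATZero E) {X : Set E} (hX : X.Nonempty)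
    (hXc : GeodesicConvex X) (y : E) {α : ℝ} (hα : 0 ≤ α) (ε : ℝ) :
    GeodesicConvex (drop X y α ε) :=
  ((hcat.hasConvexMetric.geodesicConvexFun_infDist hcat.1 hX hXc).add_const_mul
    (hcat.hasConvexMetric.geodesicConvexFun_dist y) hα).geodesicConvex_sublevel ε

/-- If `y` lies on a shortest segment from `X` to `A`, then `min(A, drop X y α ε)` is
well-posed. -/
theorem NoBifurcatingGeodesics.minWellPosed_drop (hbif : NoBifurcatingGeodesics E)
    (hg : IsGeodesicSpace E) {A X : Set E} (hAcp : IsCompact A) (hX : X.Nonempty)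
    {a₀ x₀ y : E} (ha₀ : a₀ ∈ A) (hx₀ : x₀ ∈ X) (hmin : dist a₀ x₀ = infSetDist A X) {α ε : ℝ}
    (hα : 0 < α) (hε : 0 < ε) (hxy : dist x₀ y = ε) (hya : dist y a₀ = infSetDist A X - ε) :
    infSetDist A (drop X y α ε) = infSetDist A X - ε ∧ MinWellPosed A (drop X y α ε) := by
  set m := infSetDist A X
  have hyY : y ∈ drop X y α ε := by
    simp only [drop, mem_ofPred_eq, dist_self, mul_zero, add_zero]
    exact (infDist_le_dist_of_mem hx₀).trans_eq (by rw [dist_comm, hxy])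
  have hlow : ∀ a ∈ A, ∀ z ∈ drop X y α ε, m - ε + α * dist z y ≤ dist a z := by
    intro a ha z hz
    have h1 : infDist z X + α * dist z y ≤ ε := hz
    have h2 : m ≤ infDist a X := infSetDist_le_infDist hX ha
    linarith [infDist_le_infDist_add_dist (s := X) (x := a) (y := z)]
  have hinf : infSetDist A (drop X y α ε) = m - ε := by
    refine le_antisymm ?_ (le_infSetDist ⟨a₀, ha₀⟩ ⟨y, hyY⟩ fun a ha z hz => ?_)
    · exact (infSetDist_le_dist ha₀ hyY).trans_eq (by rw [dist_comm, hya])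
    · exact (le_add_of_nonneg_right (by positivity)).trans (hlow a ha z hz)
  refine ⟨hinf, ?_⟩
  have huniq : ∀ a ∈ A, dist a y = m - ε → a = a₀ := by
    intro a ha hay
    have hxa : dist x₀ a = m := by
      refine le_antisymm ?_ ?_
      · rw [dist_comm a] at hay
        linarith [dist_triangle x₀ y a]
      · rw [dist_comm]
        exact infSetDist_le_dist ha hx₀
    rw [dist_comm] at hmin
    refine hbif.eq_of_dist_eq hg (x := x₀) (y := y) ?_ ?_ ?_ (hxa.trans hmin.symm)
    · rintro rfl
      rw [dist_self] at hxy
      exact hε.ne hxy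
    · rw [dist_comm y a]
      linarith
    · linarith
  have hseq : ∀ a z : ℕ → E, (∀ n, a n ∈ A) → (∀ n, z n ∈ drop X y α ε) →
      Tendsto (fun n => dist (a n) (z n)) atTop (nhds (m - ε)) →
      Tendsto a atTop (nhds a₀) ∧ Tendsto z atTop (nhds y) := by
    intro a z ha hz haz
    have hzy : Tendsto z atTop (nhds y) := by
      rw [tendsto_iff_dist_tendsto_zero]
      have hlim : Tendsto (fun n => (dist (a n) (z n) - (m - ε)) / α) atTop (nhds 0) := by
        simpa using (haz.sub_const (m - ε)).div_const α
      refine squeeze_zero (fun _ => dist_nonneg) (fun n => ?_) hlim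
      rw [le_div_iff₀' hα]
      linarith [hlow _ (ha n) _ (hz n)]
    refine ⟨?_, hzy⟩
    refine tendsto_of_subseq_tendsto fun ns hns => ?_
    obtain ⟨b, hb, φ, hφ, hlim⟩ := hAcp.tendsto_subseq fun n => ha (ns n)
    have hsub := hns.comp hφ.tendsto_atTop
    have hby : dist b y = m - ε :=
      tendsto_nhds_unique (hlim.dist (hzy.comp hsub)) (haz.comp hsub)
    exact ⟨φ, huniq b hb hby ▸ hlim⟩
  rw [← hinf] at hseq
  refine ⟨a₀, ha₀, y, hyY, by rw [hinf, dist_comm, hya], fun b hb z hz hbz => ?_, hseq⟩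
  obtain ⟨h1, h2⟩ := hseq (fun _ => b) (fun _ => z) (fun _ => hb) (fun _ => hz)
    (by simp only [hbz]; exact tendsto_const_nhds)
  exact ⟨tendsto_nhds_unique tendsto_const_nhds h1, tendsto_nhds_unique tendsto_const_nhds h2⟩

theorem CATZero.exists_dist_eq_infSetDist [CompleteSpace E] (hcat : CATZero E) {A X : Set E}
    (hA : A.Nonempty) (hAcp : IsCompact A) (hX : X.Nonempty) (hXcl : IsClosed X)
    (hXc : GeodesicConvex X) : ∃ a ∈ A, ∃ x ∈ X, dist a x = infSetDist A X := by
  obtain ⟨a, ha, hmin⟩ := hAcp.exists_isMinOn hA (continuous_infDist_pt X).continuousOn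
  obtain ⟨x, hx, hax⟩ := hcat.exists_dist_eq_infDist hX hXcl hXc a
  refine ⟨a, ha, x, hx, le_antisymm ?_ (infSetDist_le_dist ha hx)⟩
  refine le_infSetDist hA hX fun b hb z hz => ?_
  rw [hax]
  exact (hmin hb).trans (infDist_le_dist_of_mem hz)

theorem exists_minWellPosed_near [CompleteSpace E] (hcat : CATZero E)
    (hbif : NoBifurcatingGeodesics E) {A : Set E} (hA : A.Nonempty) (hAcp : IsCompact A)
    (X : Pbclcv E) (hpos : 0 < infSetDist X.1 A) {r : ℝ} (hr : 0 < r) :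
    ∃ Y : Pbclcv E, 0 < infSetDist Y.1 A ∧ dist X Y < r ∧ MinWellPosed A Y.1 := by
  obtain ⟨X, hX, hXb, hXcl, hXc⟩ := X
  rw [infSetDist_comm] at hpos
  obtain ⟨a₀, ha₀, x₀, hx₀, hmin⟩ := hcat.exists_dist_eq_infSetDist hA hAcp hX hXcl hXc
  obtain ⟨ε, hε, hεr⟩ := exists_between (lt_min hr hpos)
  obtain ⟨hεr, hεm⟩ := lt_min_iff.1 hεr
  have hxa : dist x₀ a₀ = infSetDist A X := by rw [dist_comm, hmin]
  obtain ⟨c, hc, hc0, hc1⟩ := hcat.1.exists_path x₀ a₀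
  rw [hxa] at hc hc1
  have hεI : ε ∈ Icc 0 (infSetDist A X) := ⟨hε.le, hεm.le⟩
  have hxy : dist x₀ (c ε) = ε := by
    rw [← hc0, hc.2 0 ⟨le_rfl, hc.1⟩ _ hεI, zero_sub, abs_neg, abs_of_pos hε]
  have hya : dist (c ε) a₀ = infSetDist A X - ε := by
    rw [← hc1, hc.2 _ hεI _ ⟨hc.1, le_rfl⟩, abs_sub_comm, abs_of_pos (sub_pos.2 hεm)]
  obtain ⟨R, hRpos, hR⟩ := hXb.subset_closedBall_lt 0 (c ε)
  have hα : 0 < ε / R := div_pos hε hRpos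
  have hXY : X ⊆ drop X (c ε) (ε / R) ε := by
    intro x hx
    simp only [drop, mem_ofPred_eq, infDist_zero_of_mem hx, zero_add]
    rw [div_mul_eq_mul_div, div_le_iff₀ hRpos]
    exact mul_le_mul_of_nonneg_left (hR hx) hε.le
  obtain ⟨hinf, hwp⟩ := hbif.minWellPosed_drop hcat.1 hAcp hX ha₀ hx₀ hmin hα hε hxy hya
  refine ⟨⟨drop X (c ε) (ε / R) ε, hX.mono hXY, isBounded_drop X _ hα ε, isClosed_drop X _ _ ε,
    hcat.geodesicConvex_drop hX hXc _ hα.le ε⟩, ?_, ?_, hwp⟩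
  · rw [infSetDist_comm, hinf]
    exact sub_pos.2 hεm
  · refine lt_of_le_of_lt (hausdorffDist_le_of_infDist hε.le (fun x hx => ?_) fun z hz => ?_) hεr
    · rw [infDist_zero_of_mem (hXY hx)]
      exact hε.le
    · have : infDist z X + ε / R * dist z (c ε) ≤ ε := hz
      linarith [mul_nonneg hα.le (dist_nonneg (x := z) (y := c ε))]

end Density

/-- in a complete CAT(0) space with no bifurcating geodesics, for `A`
compact, the sets for which `min(A,X)` is well-posed form a dense `G_δ`-set in
`P^A_{b,cl,cv}(E)`. -/
theorem statement10 {E : Type*} [MetricSpace E] [CompleteSpace E] (hcat : CATZero E)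
    (hbif : NoBifurcatingGeodesics E)
    (A : Set E) (hA : A.Nonempty) (hAcp : IsCompact A) :
    Dense {X : ↥(PAbclcv A) | MinWellPosed A X.1.1} ∧
    IsGδ {X : ↥(PAbclcv A) | MinWellPosed A X.1.1} := by
  refine ⟨Metric.dense_iff.2 fun X r hr => ?_,
    IsGδ.preimage (f := Subtype.val) continuous_subtype_val
      (isGδ_minWellPosed hA hAcp.isClosed)⟩
  obtain ⟨Z, hZ, hXZ⟩ := Metric.mem_closure_iff.1 X.2 (r / 2) (half_pos hr)
  obtain ⟨Y, hY, hZY, hwp⟩ := exists_minWellPosed_near hcat hbif hA hAcp Z hZ (half_pos hr)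
  refine ⟨⟨Y, subset_closure hY⟩, ?_, hwp⟩
  rw [mem_ball, dist_comm, Subtype.dist_eq]
  linarith [dist_triangle X.1 Z Y]
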